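/- Let p be a prime with p ≠ 2 and p ≠ 5, let e = ν_p(F(p−ε)), and let i ∈ {0, 1, …, π(p)−1} be a Lucas non-zero with respect to p (i.e., L(i) ≢ 0 (mod p)). Then for every integer λ ≥ e and every integer k with k ≡ F(i) (mod p^e), there exists n ≥ 0 with n ≡ i (mod π(p)) and F(n) ≡ k (mod p^λ). (Equivalently, the closure in ℤ_p of {F(n) : n ≥ 0, n ≡ i (mod π(p))} equals the coset F(i) + p^e ℤ_p.) -/

import Mathlib

/-- The Lucas sequence: `L 0 = 2`, `L 1 = 1`, `L (n+2) = L (n+1) + L n`. -/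
def lucas : ℕ → ℕ
  | 0 => 2
  | 1 => 1
  | n + 2 => lucas (n + 1) + lucas n

/-- The Pisano period of the Fibonacci sequence modulo `p`: the least `m ≥ 1`
with `F (n + m) ≡ F n (mod p)` for all `n`. -/
noncomputable def pisano (p : ℕ) : ℕ :=
  sInf {m | 1 ≤ m ∧ ∀ n, Nat.fib (n + m) ≡ Nat.fib n [MOD p]}

/-- The natural number `p - ε` for `p ∉ {2, 5}`. -/
def pSubEps (p : ℕ) : ℕ := if p % 5 = 1 ∨ p % 5 = 4 then p - 1 else p + 1

/-- The Wall exponent `e = ν_p (F (p - ε))`. -/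
def wallExp (p : ℕ) : ℕ := padicValNat p (Nat.fib (pSubEps p))

theorem two_mul_fib_add_and_lucas_add (m n : ℕ) :
    (2 * Nat.fib (m + n) : ℤ) = Nat.fib m * lucas n + lucas m * Nat.fib n ∧
      (2 * lucas (m + n) : ℤ) = lucas m * lucas n + 5 * (Nat.fib m * Nat.fib n) := by
  induction n using Nat.twoStepInduction with
  | zero => constructor <;> simp [lucas] <;> ring
  | one =>
    have key : (lucas m : ℤ) = 2 * Nat.fib (m + 1) - Nat.fib m ∧
        (lucas (m + 1) : ℤ) = 2 * Nat.fib (m + 2) - Nat.fib (m + 1) := by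
      induction m with
      | zero => simp [lucas]
      | succ m ih =>
        refine ⟨ih.2, ?_⟩
        have h1 : lucas (m + 1 + 1) = lucas (m + 1) + lucas m := rfl
        have h2 : Nat.fib (m + 1 + 2) = Nat.fib (m + 1) + Nat.fib (m + 2) := Nat.fib_add_two
        have h3 : Nat.fib (m + 2) = Nat.fib m + Nat.fib (m + 1) := Nat.fib_add_two
        have h4 : Nat.fib (m + 1 + 1) = Nat.fib m + Nat.fib (m + 1) := Nat.fib_add_two
        rw [h1, h2]
        push_cast [h3, h4] at ih ⊢
        linarith [ih.1, ih.2]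
    obtain ⟨h1, h2⟩ := key
    have h3 : Nat.fib (m + 2) = Nat.fib m + Nat.fib (m + 1) := Nat.fib_add_two
    push_cast [h3] at h2
    have h4 : lucas 1 = 1 := rfl
    simp only [h4, Nat.fib_one, h1, h2]
    push_cast
    constructor <;> ring
  | more n ih0 ih1 =>
    have h1 : lucas (n + 2) = lucas (n + 1) + lucas n := rfl
    have h2 : lucas (m + (n + 2)) = lucas (m + (n + 1)) + lucas (m + n) := rfl
    have h3 : Nat.fib (n + 2) = Nat.fib n + Nat.fib (n + 1) := Nat.fib_add_two
    have h4 : Nat.fib (m + (n + 2)) = Nat.fib (m + n) + Nat.fib (m + (n + 1)) := Nat.fib_add_two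
    rw [h1, h2, h3, h4]
    push_cast
    constructor
    · linear_combination ih0.1 + ih1.1
    · linear_combination ih0.2 + ih1.2

theorem two_mul_fib_add (m n : ℕ) :
    (2 * Nat.fib (m + n) : ℤ) = Nat.fib m * lucas n + lucas m * Nat.fib n :=
  (two_mul_fib_add_and_lucas_add m n).1

theorem two_mul_lucas_add (m n : ℕ) :
    (2 * lucas (m + n) : ℤ) = lucas m * lucas n + 5 * (Nat.fib m * Nat.fib n) :=
  (two_mul_fib_add_and_lucas_add m n).2

theorem lucas_sq (n : ℕ) : (lucas n : ℤ) ^ 2 = 5 * Nat.fib n ^ 2 + 4 * (-1) ^ n := by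
  induction n with
  | zero => simp [lucas]
  | succ n ih =>
    have h1 := two_mul_fib_add n 1
    have h2 := two_mul_lucas_add n 1
    have h4 : lucas 1 = 1 := rfl
    simp only [h4, Nat.fib_one, Nat.cast_one, mul_one] at h1 h2
    have h5 : (4 : ℤ) * lucas (n + 1) ^ 2 = 4 * (5 * Nat.fib (n + 1) ^ 2 + 4 * (-1) ^ (n + 1)) := by
      rw [pow_succ (-1 : ℤ)]
      linear_combination (2 * lucas (n + 1) + lucas n + 5 * Nat.fib n : ℤ) * h2
        - 5 * (2 * Nat.fib (n + 1) + (Nat.fib n + lucas n) : ℤ) * h1 - 4 * ih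
    linarith

theorem isCoprime_prime_pow_two_pow {p : ℕ} (hp : p.Prime) (hp2 : p ≠ 2) (s k : ℕ) :
    IsCoprime ((p : ℤ) ^ s) (2 ^ k) := by
  have h := Nat.isCoprime_iff_coprime.mpr ((Nat.coprime_primes hp Nat.prime_two).mpr hp2)
  exact_mod_cast h.pow

/-- If `p ^ s` divides `F M` and `L M ≡ 2 (mod p)`, then `L M ≡ 2 (mod p ^ (2 * s))`. -/
theorem prime_pow_dvd_lucas_sub_two {p : ℕ} (hp : p.Prime) (hp2 : p ≠ 2) {M s : ℕ} (hs : 1 ≤ s)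
    (hF : (p : ℤ) ^ s ∣ Nat.fib M) (hL : (p : ℤ) ∣ lucas M - 2) :
    (p : ℤ) ^ (2 * s) ∣ lucas M - 2 := by
  have hpp : Prime (p : ℤ) := Nat.prime_iff_prime_int.mp hp
  have hpF : (p : ℤ) ∣ Nat.fib M := (dvd_pow_self _ (by omega)).trans hF
  have hn2 (k : ℕ) : ¬ (p : ℤ) ∣ 2 ^ k := fun h =>
    hpp.not_isUnit ((isCoprime_prime_pow_two_pow hp hp2 1 k).isUnit_of_dvd' (by simp) h)
  have hsq := lucas_sq M
  have hF2 : (p : ℤ) ^ (2 * s) ∣ 5 * Nat.fib M ^ 2 := by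
    rw [mul_comm 2 s, pow_mul]
    exact (pow_dvd_pow_of_dvd hF 2).mul_left 5
  rcases neg_one_pow_eq_or ℤ M with h | h
  · have hprod : ((lucas M : ℤ) - 2) * (lucas M + 2) = 5 * Nat.fib M ^ 2 := by
      rw [h] at hsq; linarith
    refine (IsCoprime.pow_left ?_ :
      IsCoprime ((p : ℤ) ^ (2 * s)) (lucas M + 2)).dvd_of_dvd_mul_right (hprod ▸ hF2)
    refine (Prime.coprime_iff_not_dvd hpp).mpr fun hd => hn2 2 ?_
    have := dvd_sub hd hL
    ring_nf at this
    simpa using this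
  · refine absurd ?_ (hn2 3)
    have : (2 ^ 3 : ℤ) = 5 * Nat.fib M * Nat.fib M - (lucas M + 2) * (lucas M - 2) := by
      rw [h] at hsq; linarith
    rw [this]
    exact dvd_sub (hpF.mul_left _) (hL.mul_left _)

theorem prime_pow_dvd_fib_mul {p : ℕ} (hp : p.Prime) (hp2 : p ≠ 2) {M s : ℕ}
    (hF : (p : ℤ) ^ s ∣ Nat.fib M) (hL : (p : ℤ) ^ (2 * s) ∣ lucas M - 2) (t : ℕ) :
    (p : ℤ) ^ s ∣ Nat.fib (t * M) ∧ (p : ℤ) ^ (2 * s) ∣ lucas (t * M) - 2 ∧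
      (p : ℤ) ^ (3 * s) ∣ Nat.fib (t * M) - t * Nat.fib M := by
  have hcop (k : ℕ) : IsCoprime ((p : ℤ) ^ k) 2 := by
    simpa using isCoprime_prime_pow_two_pow hp hp2 k 1
  induction t with
  | zero => simp [lucas]
  | succ t ih =>
    obtain ⟨h1, h2, h3⟩ := ih
    have a1 := two_mul_fib_add (t * M) M
    have a2 := two_mul_lucas_add (t * M) M
    rw [Nat.succ_mul]
    have e2 : (p : ℤ) ^ (2 * s) = p ^ s * p ^ s := by ring
    have e3 : (p : ℤ) ^ (3 * s) = p ^ s * p ^ (2 * s) := by ring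
    refine ⟨(hcop _).dvd_of_dvd_mul_left ?_, (hcop _).dvd_of_dvd_mul_left ?_,
      (hcop _).dvd_of_dvd_mul_left ?_⟩
    · rw [a1]
      exact dvd_add (h1.mul_right _) (hF.mul_left _)
    · have : (2 * (lucas (t * M + M) - 2) : ℤ) = (lucas (t * M) - 2) * lucas M
          + 2 * (lucas M - 2) + 5 * (Nat.fib (t * M) * Nat.fib M) := by
        linear_combination a2
      rw [this]
      exact dvd_add (dvd_add (h2.mul_right _) (hL.mul_left _))
        ((e2 ▸ mul_dvd_mul h1 hF).mul_left _)
    · have : (2 * (Nat.fib (t * M + M) - ((t + 1 : ℕ) : ℤ) * Nat.fib M) : ℤ)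
          = Nat.fib (t * M) * (lucas M - 2) + 2 * (Nat.fib (t * M) - t * Nat.fib M)
            + Nat.fib M * (lucas (t * M) - 2) := by
        push_cast
        linear_combination a1
      rw [this]
      exact dvd_add (dvd_add (e3 ▸ mul_dvd_mul h1 hL) (h3.mul_left _))
        (e3 ▸ mul_dvd_mul hF h2)

/-- Over a field, if `d ^ 2 = 5`, then Binet's formula holds. -/
theorem binet_of_sq_eq_five {K : Type*} [Field K] {d : K} (hd : d ^ 2 = 5) (h2 : (2 : K) ≠ 0)
    (n : ℕ) : d * Nat.fib n = ((1 + d) / 2) ^ n - ((1 - d) / 2) ^ n := by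
  induction n using Nat.twoStepInduction with
  | zero => simp
  | one => simp; field_simp; ring
  | more n ih0 ih1 =>
    have ha : ((1 + d) / 2) ^ 2 = (1 + d) / 2 + 1 := by field_simp; linear_combination hd
    have hb : ((1 - d) / 2) ^ 2 = (1 - d) / 2 + 1 := by field_simp; linear_combination hd
    rw [Nat.fib_add_two, pow_add, pow_add _ n 2, ha, hb]
    push_cast
    rw [mul_add, ih0, ih1]
    ring

theorem legendreSym_five_eq_one [Fact (Nat.Prime 5)] {r : ℕ} (hr : r = 1 ∨ r = 4) :
    legendreSym 5 r = 1 := by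
  have h1 : @legendreSym 5 ⟨Nat.prime_five⟩ 1 = 1 := by decide
  have h4 : @legendreSym 5 ⟨Nat.prime_five⟩ 4 = 1 := by decide
  rcases hr with rfl | rfl
  exacts [h1, h4]

theorem legendreSym_five_eq_neg_one [Fact (Nat.Prime 5)] {r : ℕ} (hr : r = 2 ∨ r = 3) :
    legendreSym 5 r = -1 := by
  have h2 : @legendreSym 5 ⟨Nat.prime_five⟩ 2 = -1 := by decide
  have h3 : @legendreSym 5 ⟨Nat.prime_five⟩ 3 = -1 := by decide
  rcases hr with rfl | rfl
  exacts [h2, h3]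

theorem prime_dvd_fib_pSubEps {p : ℕ} (hp : p.Prime) (hp2 : p ≠ 2) (hp5 : p ≠ 5) :
    p ∣ Nat.fib (pSubEps p) := by
  have : Fact p.Prime := ⟨hp⟩
  have : Fact (Nat.Prime 5) := ⟨by norm_num⟩
  let K := AlgebraicClosure (ZMod p)
  have : CharP K p := charP_of_injective_algebraMap (algebraMap (ZMod p) K).injective p
  have h2 : (2 : K) ≠ 0 := by
    intro h
    have := (CharP.cast_eq_zero_iff K p 2).mp (by exact_mod_cast h)
    exact hp2 ((Nat.prime_dvd_prime_iff_eq hp Nat.prime_two).mp this)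
  have h5 : (5 : K) ≠ 0 := by
    intro h
    have := (CharP.cast_eq_zero_iff K p 5).mp (by exact_mod_cast h)
    exact hp5 ((Nat.prime_dvd_prime_iff_eq hp (by norm_num)).mp this)
  obtain ⟨d, hd⟩ := IsAlgClosed.exists_pow_nat_eq (5 : K) (n := 2) (by norm_num)
  have hd0 : d ≠ 0 := by
    rintro rfl
    exact h5 (by simpa using hd.symm)
  have hodd : p = 2 * (p / 2) + 1 := by
    have := hp.eq_two_or_odd
    omega
  have hleg : d ^ p = d * ((legendreSym p 5 : ℤ) : K) := by
    have h := congrArg (algebraMap (ZMod p) K) (legendreSym.eq_pow p 5)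
    simp only [map_intCast, map_pow] at h
    rw [h]
    have hpow : d ^ p = d ^ (2 * (p / 2) + 1) := congrArg (d ^ ·) hodd
    rw [hpow, pow_succ, pow_mul, hd, mul_comm]
    push_cast
    rfl
  have hrec : legendreSym p 5 = legendreSym 5 p := by
    exact_mod_cast legendreSym.quadratic_reciprocity_one_mod_four (p := 5) (q := p)
      (by norm_num) hp2
  have hmod : legendreSym 5 p = legendreSym 5 ((p % 5 : ℕ) : ℤ) := by
    rw [legendreSym.mod]
    norm_cast
  have h2p : (2 : K) ^ p = 2 := by
    have := map_ofNat (frobenius K p) 2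
    simpa [frobenius_def] using this
  have hplus : ((1 + d) / 2) ^ p = (1 + d ^ p) / 2 := by
    rw [div_pow, add_pow_char, one_pow, h2p]
  have hminus : ((1 - d) / 2) ^ p = (1 - d ^ p) / 2 := by
    rw [div_pow, sub_pow_char, one_pow, h2p]
  have ha0 : (1 + d) / 2 * ((1 - d) / 2) = -1 := by
    have h4 : (2 : K) * 2 ≠ 0 := mul_ne_zero h2 h2
    rw [div_mul_div_comm, div_eq_iff h4]
    linear_combination -hd
  refine (CharP.cast_eq_zero_iff K p _).mp ((mul_eq_zero.mp ?_).resolve_left hd0)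
  rw [binet_of_sq_eq_five hd h2]
  have hp50 : p % 5 ≠ 0 := fun h =>
    hp5 (((Nat.prime_dvd_prime_iff_eq (by norm_num) hp).mp (Nat.dvd_of_mod_eq_zero h)).symm)
  unfold pSubEps
  split_ifs with hcase
  · have hl : legendreSym p 5 = 1 := by
      rw [hrec, hmod]
      exact legendreSym_five_eq_one hcase
    rw [hl, Int.cast_one, mul_one] at hleg
    rw [hleg] at hplus hminus
    have hane : (1 + d) / 2 ≠ 0 := left_ne_zero_of_mul (ha0 ▸ neg_ne_zero.mpr one_ne_zero)
    have hbne : (1 - d) / 2 ≠ 0 := right_ne_zero_of_mul (ha0 ▸ neg_ne_zero.mpr one_ne_zero)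
    rw [pow_sub₀ _ hane hp.one_le, pow_sub₀ _ hbne hp.one_le, hplus, hminus,
      pow_one, pow_one, mul_inv_cancel₀ hane, mul_inv_cancel₀ hbne, sub_self]
  · have hl : legendreSym p 5 = -1 := by
      rw [hrec, hmod]
      exact legendreSym_five_eq_neg_one (by omega)
    rw [hl] at hleg
    push_cast at hleg
    rw [pow_succ, pow_succ, hplus, hminus, hleg]
    ring

theorem lucas_two_mul_sub_two {m : ℕ} (hm : Even m) :
    (lucas (2 * m) : ℤ) - 2 = 5 * Nat.fib m * Nat.fib m := by
  have h1 := two_mul_lucas_add m m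
  have h2 := lucas_sq m
  rw [hm.neg_one_pow] at h2
  rw [two_mul]
  linarith

theorem fib_two_mul_eq_mul_lucas (m : ℕ) : Nat.fib (2 * m) = Nat.fib m * lucas m := by
  have h1 := two_mul_fib_add m m
  rw [two_mul]
  zify
  linarith

theorem fib_add_modEq {p : ℕ} (hp : p.Prime) (hp2 : p ≠ 2) {M : ℕ}
    (hF : (p : ℤ) ∣ Nat.fib M) (hL : (p : ℤ) ∣ lucas M - 2) (n : ℕ) :
    Nat.fib (n + M) ≡ Nat.fib n [MOD p] := by
  have hcop : IsCoprime (p : ℤ) 2 := by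
    simpa using isCoprime_prime_pow_two_pow hp hp2 1 1
  rw [Nat.ModEq.comm, Nat.modEq_iff_dvd]
  refine hcop.dvd_of_dvd_mul_left ?_
  have : (2 * (Nat.fib (n + M) - Nat.fib n) : ℤ)
      = Nat.fib n * (lucas M - 2) + lucas n * Nat.fib M := by
    linear_combination two_mul_fib_add n M
  rw [this]
  exact dvd_add (hL.mul_left _) (hF.mul_left _)

theorem pisano_spec {p N : ℕ} (hN : 1 ≤ N)
    (h : ∀ n, Nat.fib (n + N) ≡ Nat.fib n [MOD p]) :
    1 ≤ pisano p ∧ (∀ n, Nat.fib (n + pisano p) ≡ Nat.fib n [MOD p]) ∧ pisano p ∣ N := by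
  have hmem : pisano p ∈ {m | 1 ≤ m ∧ ∀ n, Nat.fib (n + m) ≡ Nat.fib n [MOD p]} :=
    Nat.sInf_mem ⟨N, hN, h⟩
  refine ⟨hmem.1, hmem.2, ?_⟩
  have hmul : ∀ t n, Nat.fib (n + pisano p * t) ≡ Nat.fib n [MOD p] := by
    intro t
    induction t with
    | zero => intro n; exact Nat.ModEq.refl _
    | succ t ih =>
      intro n
      rw [Nat.mul_succ, ← Nat.add_assoc]
      exact (hmem.2 _).trans (ih n)
  by_contra hnd
  have hr : 1 ≤ N % pisano p := Nat.pos_of_ne_zero fun h0 => hnd (Nat.dvd_of_mod_eq_zero h0)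
  have hper : ∀ n, Nat.fib (n + N % pisano p) ≡ Nat.fib n [MOD p] := by
    intro n
    have h1 := hmul (N / pisano p) (n + N % pisano p)
    rw [Nat.add_assoc, Nat.mod_add_div] at h1
    exact h1.symm.trans (h n)
  have hle : pisano p ≤ N % pisano p := Nat.sInf_le ⟨hr, hper⟩
  exact absurd (Nat.mod_lt N hmem.1) (not_lt.mpr hle)

theorem lucas_eq_two_mul_fib_succ_sub (m : ℕ) :
    (lucas m : ℤ) = 2 * Nat.fib (m + 1) - Nat.fib m := by
  have h := two_mul_fib_add m 1
  have h1 : lucas 1 = 1 := rfl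
  simp only [h1, Nat.fib_one, Nat.cast_one, mul_one] at h
  linarith

/-- The Pisano period is a point where `L ≡ 2 (mod p)` and `F` has `p`-adic valuation exactly `e`. -/
theorem pisano_wallExp_spec {p : ℕ} (hp : p.Prime) (hp2 : p ≠ 2) (hp5 : p ≠ 5) :
    1 ≤ wallExp p ∧ (p : ℤ) ∣ lucas (pisano p) - 2 ∧
      (p : ℤ) ^ wallExp p ∣ Nat.fib (pisano p) ∧
      ¬ (p : ℤ) ^ (wallExp p + 1) ∣ Nat.fib (pisano p) := by
  have : Fact p.Prime := ⟨hp⟩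
  have hpp : Prime (p : ℤ) := Nat.prime_iff_prime_int.mp hp
  set m := pSubEps p with hm
  have hp3 : 3 ≤ p := by have := hp.two_le; omega
  have hodd : p % 2 = 1 := hp.eq_two_or_odd.resolve_left hp2
  have hm0 : 1 ≤ m := by rw [hm]; unfold pSubEps; split_ifs <;> omega
  have hmeven : Even m := by
    rw [Nat.even_iff, hm]; unfold pSubEps; split_ifs <;> omega
  have hmp : ¬ p ∣ m := by
    rw [hm]
    unfold pSubEps
    split_ifs
    · exact Nat.not_dvd_of_pos_of_lt (by omega) (by omega)
    · intro h
      have := (Nat.dvd_add_right (dvd_refl p)).mp h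
      exact hp.one_lt.ne' (Nat.dvd_one.mp this)
  have hn2 : ¬ p ∣ 2 := fun h => hp2 ((Nat.prime_dvd_prime_iff_eq hp Nat.prime_two).mp h)
  have hdvd : p ∣ Nat.fib m := prime_dvd_fib_pSubEps hp hp2 hp5
  have hdvdZ : (p : ℤ) ∣ Nat.fib m := Int.natCast_dvd_natCast.mpr hdvd
  have hfm0 : Nat.fib m ≠ 0 := (Nat.fib_pos.mpr hm0).ne'
  have hLm : ¬ p ∣ lucas m := by
    intro h
    have hZ : (p : ℤ) ∣ lucas m := Int.natCast_dvd_natCast.mpr h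
    have h4 : (p : ℤ) ∣ 2 ^ 2 := by
      have hsq := lucas_sq m
      rw [hmeven.neg_one_pow] at hsq
      have : (2 ^ 2 : ℤ) = lucas m * lucas m - 5 * Nat.fib m * Nat.fib m := by linarith
      rw [this]
      exact dvd_sub (hZ.mul_left _) (hdvdZ.mul_left _)
    exact hn2 (by exact_mod_cast hpp.dvd_of_dvd_pow h4)
  have hFN : (p : ℤ) ∣ Nat.fib (2 * m) := by
    rw [fib_two_mul_eq_mul_lucas]
    push_cast
    exact hdvdZ.mul_right _
  have hLN : (p : ℤ) ∣ lucas (2 * m) - 2 := by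
    rw [lucas_two_mul_sub_two hmeven]
    exact hdvdZ.mul_left _
  obtain ⟨hpi, hper, t, ht⟩ := pisano_spec (by omega) (fib_add_modEq hp hp2 hFN hLN)
  have hFpi : p ∣ Nat.fib (pisano p) := by
    have := hper 0
    rw [Nat.zero_add, Nat.fib_zero] at this
    exact (Nat.modEq_zero_iff_dvd).mp this
  have hFpiZ : (p : ℤ) ∣ Nat.fib (pisano p) := Int.natCast_dvd_natCast.mpr hFpi
  have hLpi : (p : ℤ) ∣ lucas (pisano p) - 2 := by
    have h1 := (Nat.modEq_iff_dvd.mp (hper 1).symm)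
    rw [Nat.add_comm 1, Nat.fib_one] at h1
    have : (lucas (pisano p) - 2 : ℤ)
        = 2 * (Nat.fib (pisano p + 1) - (1 : ℕ)) - Nat.fib (pisano p) := by
      push_cast
      linarith [lucas_eq_two_mul_fib_succ_sub (pisano p)]
    rw [this]
    exact dvd_sub (h1.mul_left _) hFpiZ
  have hfpi0 : Nat.fib (pisano p) ≠ 0 := (Nat.fib_pos.mpr hpi).ne'
  have htp : ¬ p ∣ t := by
    intro h
    have h1 : p ∣ 2 * m := ht ▸ h.mul_left _
    exact (hp.dvd_mul.mp h1).elim hn2 hmp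
  set s := padicValNat p (Nat.fib (pisano p)) with hs
  have hs1 : 1 ≤ s := one_le_padicValNat_of_dvd hfpi0 hFpi
  have hsd : (p : ℤ) ^ s ∣ Nat.fib (pisano p) := by exact_mod_cast pow_padicValNat_dvd
  have hsn : ¬ (p : ℤ) ^ (s + 1) ∣ Nat.fib (pisano p) := by
    exact_mod_cast pow_succ_padicValNat_not_dvd hfpi0
  obtain ⟨hd1, -, hd3⟩ := prime_pow_dvd_fib_mul hp hp2 hsd
    (prime_pow_dvd_lucas_sub_two hp hp2 hs1 hsd hLpi) t
  rw [mul_comm t, ← ht] at hd1 hd3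
  have hd2 : ¬ (p : ℤ) ^ (s + 1) ∣ Nat.fib (2 * m) := by
    intro h
    have h1 := (dvd_sub_right h).mp ((pow_dvd_pow (p : ℤ) (by omega : s + 1 ≤ 3 * s)).trans hd3)
    refine hsn (IsCoprime.dvd_of_dvd_mul_left (IsCoprime.pow_left ?_) h1)
    exact (Prime.coprime_iff_not_dvd hpp).mpr fun h' => htp (Int.natCast_dvd_natCast.mp h')
  have hval : padicValNat p (Nat.fib (2 * m)) = wallExp p := by
    have hl0 : lucas m ≠ 0 := fun h => hLm (h ▸ dvd_zero p)
    rw [fib_two_mul_eq_mul_lucas, padicValNat.mul hfm0 hl0,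
      padicValNat.eq_zero_of_not_dvd hLm, add_zero]
    rfl
  have hse : s = wallExp p := by
    have hN0 : Nat.fib (2 * m) ≠ 0 := (Nat.fib_pos.mpr (by omega)).ne'
    rw [← hval]
    apply le_antisymm
    · exact (padicValNat_dvd_iff_le hN0).mp (by exact_mod_cast hd1)
    · by_contra hlt
      exact hd2 (by exact_mod_cast (padicValNat_dvd_iff_le (n := s + 1) hN0).mpr (by omega))
  rw [← hse]
  exact ⟨hs1, hLpi, hsd, hsn⟩

theorem pisano_mul_pow_spec {p : ℕ} (hp : p.Prime) (hp2 : p ≠ 2) (hp5 : p ≠ 5) (j : ℕ) :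
    (p : ℤ) ^ (2 * (wallExp p + j)) ∣ lucas (p ^ j * pisano p) - 2 ∧
      (p : ℤ) ^ (wallExp p + j) ∣ Nat.fib (p ^ j * pisano p) ∧
      ¬ (p : ℤ) ^ (wallExp p + j + 1) ∣ Nat.fib (p ^ j * pisano p) := by
  obtain ⟨he, hL, hF, hnF⟩ := pisano_wallExp_spec hp hp2 hp5
  have hp0 : (p : ℤ) ≠ 0 := by exact_mod_cast hp.ne_zero
  induction j with
  | zero =>
    simp only [pow_zero, one_mul, add_zero]
    exact ⟨prime_pow_dvd_lucas_sub_two hp hp2 he hF hL, hF, hnF⟩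
  | succ j ih =>
    obtain ⟨h1, h2, h3⟩ := ih
    obtain ⟨k1, k2, k3⟩ := prime_pow_dvd_fib_mul hp hp2 h2 h1 p
    rw [← mul_assoc, ← pow_succ'] at k1 k2 k3
    have hF' : (p : ℤ) ^ (wallExp p + (j + 1)) ∣ Nat.fib (p ^ (j + 1) * pisano p) := by
      refine (dvd_sub_left ?_).mp
        ((pow_dvd_pow (p : ℤ) (by omega : _ ≤ 3 * (wallExp p + j))).trans k3)
      rw [← add_assoc, pow_succ']
      exact mul_dvd_mul_left _ h2
    refine ⟨prime_pow_dvd_lucas_sub_two hp hp2 (by omega) hF'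
      ((dvd_pow_self _ (by omega)).trans k2), hF', fun h => h3 ?_⟩
    have h4 := (dvd_sub_right h).mp
      ((pow_dvd_pow (p : ℤ) (by omega : _ ≤ 3 * (wallExp p + j))).trans k3)
    rw [← add_assoc, pow_succ' _ (wallExp p + j + 1)] at h4
    exact (mul_dvd_mul_iff_left hp0).mp h4

theorem two_mul_fib_add_mul_sub {p : ℕ} {M s : ℕ} (hp : p.Prime) (hp2 : p ≠ 2) (hs : 1 ≤ s)
    (hF : (p : ℤ) ^ s ∣ Nat.fib M) (hL : (p : ℤ) ^ (2 * s) ∣ lucas M - 2) (n t : ℕ) :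
    (p : ℤ) ^ (s + 1) ∣ 2 * Nat.fib (n + t * M) - (2 * Nat.fib n + t * (lucas n * Nat.fib M)) := by
  obtain ⟨h1, h2, h3⟩ := prime_pow_dvd_fib_mul hp hp2 hF hL t
  have : (2 * Nat.fib (n + t * M) - (2 * Nat.fib n + t * (lucas n * Nat.fib M)) : ℤ)
      = Nat.fib n * (lucas (t * M) - 2) + lucas n * (Nat.fib (t * M) - t * Nat.fib M) := by
    linear_combination two_mul_fib_add n (t * M)
  rw [this]
  exact dvd_add (((pow_dvd_pow _ (by omega)).trans h2).mul_left _)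
    (((pow_dvd_pow _ (by omega)).trans h3).mul_left _)

theorem exists_nat_dvd_sub_mul {p : ℕ} (hp : p.Prime) {a : ℤ} (ha : ¬ (p : ℤ) ∣ a) (c : ℤ) :
    ∃ t : ℕ, (p : ℤ) ∣ t * a - c := by
  have : Fact p.Prime := ⟨hp⟩
  have ha' : (a : ZMod p) ≠ 0 := fun h => ha ((ZMod.intCast_zmod_eq_zero_iff_dvd a p).mp h)
  refine ⟨((c : ZMod p) / a).val, (ZMod.intCast_zmod_eq_zero_iff_dvd _ p).mp ?_⟩
  push_cast
  rw [ZMod.natCast_zmod_val, div_mul_cancel₀ _ ha', sub_self]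

theorem not_dvd_lucas_add_mul_pisano {p : ℕ} (hp : p.Prime) (hp2 : p ≠ 2) (hp5 : p ≠ 5)
    {i : ℕ} (hi : ¬ p ∣ lucas i) (t : ℕ) : ¬ (p : ℤ) ∣ lucas (i + t * pisano p) := by
  obtain ⟨he, hL, hF, -⟩ := pisano_wallExp_spec hp hp2 hp5
  obtain ⟨h1, h2, -⟩ := prime_pow_dvd_fib_mul hp hp2 hF
    (prime_pow_dvd_lucas_sub_two hp hp2 he hF hL) t
  replace h1 := (dvd_pow_self (p : ℤ) (by omega)).trans h1
  replace h2 := (dvd_pow_self (p : ℤ) (by omega)).trans h2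
  intro h
  have hcop : IsCoprime (p : ℤ) 2 := by
    simpa using isCoprime_prime_pow_two_pow hp hp2 1 1
  refine hi (Int.natCast_dvd_natCast.mp (hcop.dvd_of_dvd_mul_left ?_))
  have : (2 * lucas i : ℤ) = 2 * lucas (i + t * pisano p) - lucas i * (lucas (t * pisano p) - 2)
      - 5 * Nat.fib i * Nat.fib (t * pisano p) := by
    linear_combination -two_mul_lucas_add i (t * pisano p)
  rw [this]
  exact dvd_sub (dvd_sub (h.mul_left _) (h2.mul_left _)) (h1.mul_left _)

theorem exists_fib_add_mul_pisano_sub_dvd {p : ℕ} (hp : p.Prime) (hp2 : p ≠ 2) (hp5 : p ≠ 5)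
    {i : ℕ} (hi : ¬ p ∣ lucas i) {k : ℤ} (hk : (p : ℤ) ^ wallExp p ∣ Nat.fib i - k) (j : ℕ) :
    ∃ t : ℕ, (p : ℤ) ^ (wallExp p + j) ∣ Nat.fib (i + t * pisano p) - k := by
  have hpp : Prime (p : ℤ) := Nat.prime_iff_prime_int.mp hp
  induction j with
  | zero => exact ⟨0, by simpa using hk⟩
  | succ j ih =>
    obtain ⟨t, c, hc⟩ := ih
    have he := (pisano_wallExp_spec hp hp2 hp5).1
    obtain ⟨h1, ⟨b, hb⟩, h3⟩ := pisano_mul_pow_spec hp hp2 hp5 j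
    have hpb : ¬ (p : ℤ) ∣ b := by
      intro h
      apply h3
      rw [hb, pow_succ]
      exact mul_dvd_mul_left _ h
    have hpl : ¬ (p : ℤ) ∣ lucas (i + t * pisano p) * b :=
      hpp.not_dvd_mul (not_dvd_lucas_add_mul_pisano hp hp2 hp5 hi t) hpb
    obtain ⟨u, v, hv⟩ := exists_nat_dvd_sub_mul hp hpl (-2 * c)
    refine ⟨t + u * p ^ j, ?_⟩
    have key := two_mul_fib_add_mul_sub hp hp2 (by omega) ⟨b, hb⟩ h1 (i + t * pisano p) u
    have e1 : i + (t + u * p ^ j) * pisano p = i + t * pisano p + u * (p ^ j * pisano p) := by ring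
    have hcop : IsCoprime ((p : ℤ) ^ (wallExp p + (j + 1))) 2 := by
      simpa using isCoprime_prime_pow_two_pow hp hp2 (wallExp p + (j + 1)) 1
    refine hcop.dvd_of_dvd_mul_left ?_
    rw [e1, ← add_assoc]
    refine (dvd_sub_left (c := 2 * (Nat.fib (i + t * pisano p) - k)
      + u * (lucas (i + t * pisano p) * Nat.fib (p ^ j * pisano p))) ?_).mp ?_
    · refine ⟨v, ?_⟩
      rw [hc, hb]
      linear_combination (p : ℤ) ^ (wallExp p + j) * hv
    · refine Eq.mp (congrArg _ ?_) key
      ring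

theorem lucas_nonzero_full_branching
    (p : ℕ) (hp : p.Prime) (hp2 : p ≠ 2) (hp5 : p ≠ 5)
    (i : ℕ) (hi : i < pisano p) (hL : ¬ p ∣ lucas i) :
    ∀ lam : ℕ, wallExp p ≤ lam → ∀ k : ℤ,
      (k : ZMod (p ^ wallExp p)) = (Nat.fib i : ZMod (p ^ wallExp p)) →
      ∃ n : ℕ, n % pisano p = i ∧
        ((Nat.fib n : ℤ) : ZMod (p ^ lam)) = (k : ZMod (p ^ lam)) := by
  intro lam hlam k hk
  obtain ⟨j, rfl⟩ := Nat.exists_eq_add_of_le hlam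
  have hk' : (p : ℤ) ^ wallExp p ∣ Nat.fib i - k := by
    have := (ZMod.intCast_eq_intCast_iff_dvd_sub k (Nat.fib i) (p ^ wallExp p)).mp
      (by exact_mod_cast hk)
    exact_mod_cast this
  obtain ⟨t, ht⟩ := exists_fib_add_mul_pisano_sub_dvd hp hp2 hp5 hL hk' j
  refine ⟨i + t * pisano p, ?_, ?_⟩
  · rw [Nat.add_mul_mod_self_right, Nat.mod_eq_of_lt hi]
  · refine ((ZMod.intCast_eq_intCast_iff_dvd_sub k _ _).mpr ?_).symm
    exact_mod_cast ht
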